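/- arXiv:2212.05692 — 2 statements merged into one kernel-verified Lean document; each statement's English description precedes it below -/
import Mathlib

section
/- Let f(z) = ∑_{k=0}^∞ a_k z^k be an entire function with a_k > 0 for all k. Suppose there exists α with 1 + √5 ≤ α < 4 such that q_k(f) ∈ [α, 8/(α(4 − α))] for all k ≥ 2. Then every complex zero of f is real (and negative). -/
/-- Positivity and second-quotient bounds for the initial segment `a 0, …, a n`. -/
def QC (α β : ℝ) (n : ℕ) (a : ℕ → ℝ) : Prop :=
  (∀ k, k ≤ n → 0 < a k) ∧
  ∀ k, k + 2 ≤ n → α * (a k * a (k+2)) ≤ a (k+1) ^ 2 ∧ a (k+1) ^ 2 ≤ β * (a k * a (k+2))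

lemma QC.scale {α β : ℝ} {n : ℕ} {a : ℕ → ℝ} (h : QC α β n a) {x : ℝ} (hx : 0 < x) :
    QC α β n (fun j => a j * x ^ j) := by
  refine ⟨fun k hk => mul_pos (h.1 k hk) (pow_pos hx k), fun k hk => ?_⟩
  obtain ⟨h1, h2⟩ := h.2 k hk
  have hp : 0 ≤ x ^ (2 * k + 2) := by positivity
  have e1 : (a (k+1) * x ^ (k+1)) ^ 2 = a (k+1) ^ 2 * x ^ (2 * k + 2) := by ring
  have e2 : a k * x ^ k * (a (k+2) * x ^ (k+2)) = a k * a (k+2) * x ^ (2*k+2) := by ring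
  constructor
  · simp only [e1, e2]
    nlinarith [mul_le_mul_of_nonneg_right h1 hp]
  · simp only [e1, e2]
    nlinarith [mul_le_mul_of_nonneg_right h2 hp]

lemma QC.rev {α β : ℝ} {n : ℕ} {a : ℕ → ℝ} (h : QC α β n a) :
    QC α β n (fun j => a (n - j)) := by
  refine ⟨fun k hk => h.1 _ (by omega), fun k hk => ?_⟩
  have := h.2 (n - (k+2)) (by omega)
  have e1 : n - (k+2) + 1 = n - (k+1) := by omega
  have e2 : n - (k+2) + 2 = n - k := by omega
  rw [e1, e2, mul_comm (a (n - (k+2)))] at this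
  exact this

lemma QC.take {α β : ℝ} {n m : ℕ} {a : ℕ → ℝ} (h : QC α β n a) (hm : m ≤ n) :
    QC α β m a := ⟨fun k hk => h.1 k (by omega), fun k hk => h.2 k (by omega)⟩

lemma QC.shift {α β : ℝ} {n m k : ℕ} {a : ℕ → ℝ} (h : QC α β n a) (hm : k + m ≤ n) :
    QC α β m (fun j => a (k + j)) :=
  ⟨fun j hj => h.1 _ (by omega), fun j hj => h.2 (k + j) (by omega)⟩

lemma alt_sum (m : ℕ) : ∀ (c : ℕ → ℝ), (∀ j, j ≤ m → 0 < c j) →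
    (∀ j, j < m → c (j+1) < c j) →
    0 < ∑ j ∈ Finset.range (m+1), (-1 : ℝ) ^ j * c j ∧
    ∑ j ∈ Finset.range (m+1), (-1 : ℝ) ^ j * c j ≤ c 0 := by
  induction m with
  | zero => intro c h1 _; simpa using h1 0
  | succ m ih =>
    intro c h1 h2
    obtain ⟨i1, i2⟩ := ih (fun j => c (j+1)) (fun j hj => h1 _ (by omega))
      (fun j hj => h2 _ (by omega))
    rw [Finset.sum_range_succ']
    have e : ∑ k ∈ Finset.range (m+1), (-1 : ℝ) ^ (k+1) * c (k+1) =
        - ∑ k ∈ Finset.range (m+1), (-1 : ℝ) ^ k * c (k+1) := by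
      rw [← Finset.sum_neg_distrib]
      exact Finset.sum_congr rfl fun k _ => by ring
    rw [e]
    have := h2 0 (by omega)
    simp only [zero_add] at *
    constructor <;> linarith

lemma QC.dec {α β : ℝ} {n : ℕ} {a : ℕ → ℝ} (hα : 1 < α) (h : QC α β n a) (h01 : a 1 < a 0) :
    ∀ j, j < n → a (j+1) < a j := by
  intro j
  induction j with
  | zero => intro _; exact h01
  | succ j ih =>
    intro hj
    have i := ih (by omega)
    have p0 := h.1 j (by omega)
    have p1 := h.1 (j+1) (by omega)
    have p2 := h.1 (j+2) (by omega)
    have q := (h.2 j (by omega)).1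
    show a (j+2) < a (j+1)
    by_contra hc
    push Not at hc
    have : a (j+1) * a (j+1) < a j * a (j+2) :=
      mul_lt_mul i hc p1 p0.le
    nlinarith [mul_pos p0 p2]

/-- Ratios `a k / a (k+1)` increase. -/
lemma QC.ratio {α β : ℝ} {n : ℕ} {a : ℕ → ℝ} (hα : 1 < α) (h : QC α β n a) (k : ℕ)
    (hk : k + 2 ≤ n) : a k / a (k+1) < a (k+1) / a (k+2) := by
  have p0 := h.1 k (by omega)
  have p1 := h.1 (k+1) (by omega)
  have p2 := h.1 (k+2) (by omega)
  have q := (h.2 k (by omega)).1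
  rw [div_lt_div_iff₀ p1 p2]
  nlinarith [mul_pos p0 p2]

lemma num_half (α t : ℝ) (h1 : 3.23 ≤ α) (h2 : α < 4) (ht : 0 < t) (ht2 : t ^ 2 * α ≤ 1) :
    0 < 1 / 2 - t + 0.1175 * t ^ 2 * (α * (4 - α)) := by
  obtain ⟨r, hr0, hr⟩ : ∃ r : ℝ, 0 < r ∧ r ^ 2 = α :=
    ⟨√α, Real.sqrt_pos.2 (by linarith), Real.sq_sqrt (by linarith)⟩
  subst hr
  have r1 : 1.79 ≤ r := by nlinarith
  have r2 : r < 2 := by nlinarith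
  set p := t * r with hp
  have p0 : 0 < p := mul_pos ht hr0
  have p1 : p ≤ 1 := by
    have : p ^ 2 ≤ 1 := by rw [hp]; nlinarith
    nlinarith
  have key : 0 < r / 2 - p + 0.1175 * p ^ 2 * (r * (4 - r ^ 2)) := by
    have w0 : 0 ≤ r * (4 - r^2) := by nlinarith
    have w1 : r * (4 - r^2) ≤ 1.6 := by nlinarith
    have A : 0 < (2 - r) * (0.1175 * r * (2 + r) - 1 / 2) := by
      apply mul_pos <;> nlinarith
    have B : 0 ≤ (1 - p) * (1 - 0.1175 * (1 + p) * (r * (4 - r^2))) := by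
      apply mul_nonneg
      · linarith
      · nlinarith [mul_le_mul (show 1 + p ≤ 2 by linarith) w1 w0 (by norm_num)]
    nlinarith
  have e : r / 2 - p + 0.1175 * p ^ 2 * (r * (4 - r ^ 2)) =
      r * (1 / 2 - t + 0.1175 * t ^ 2 * (r^2 * (4 - r^2))) := by
    rw [hp]; ring
  rw [e] at key
  exact (pos_iff_pos_of_mul_pos key).1 hr0

lemma half_sum {α β : ℝ} (h1 : 3.23 ≤ α) (h2 : α < 4) (hβ : β * (α * (4 - α)) = 8)
    {m : ℕ} (hm : 2 ≤ m) {c : ℕ → ℝ} (h : QC α β m c) {t : ℝ} (ht : 0 < t)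
    (ht2 : t ^ 2 * α ≤ 1) (hc : c 1 = t * c 0) :
    c 0 / 2 < ∑ j ∈ Finset.range (m+1), (-1 : ℝ) ^ j * c j := by
  have p0 := h.1 0 (by omega)
  have p1 := h.1 1 (by omega)
  have p2 := h.1 2 (by omega)
  have t1 : t < 0.56 := by nlinarith
  have hβ0 : 0 < β := by
    have : 0 < α * (4 - α) := by nlinarith
    by_contra hn
    push Not at hn
    nlinarith
  obtain ⟨q1, q2⟩ := h.2 0 (by omega)
  simp only [zero_add] at q1 q2
  have dec := h.dec (by linarith) (by nlinarith)
  -- lower bound on `c 2`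
  have l2 : t ^ 2 * (α * (4 - α)) / 8 * c 0 ≤ c 2 := by
    have e : β * (t ^ 2 * (α * (4 - α)) / 8 * c 0) = t ^ 2 * c 0 := by
      linear_combination (t^2 * c 0 / 8) * hβ
    have : t ^ 2 * c 0 ≤ β * c 2 := by
      rw [hc] at q2
      have : c 0 * (t ^ 2 * c 0) ≤ c 0 * (β * c 2) := by nlinarith
      exact le_of_mul_le_mul_left this p0
    rw [← e] at this
    exact le_of_mul_le_mul_left this hβ0
  have num := num_half α t h1 h2 ht ht2
  have num2 := mul_pos num p0
  obtain rfl | hm3 : m = 2 ∨ 3 ≤ m := by omega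
  · simp only [Finset.sum_range_succ, Finset.sum_range_zero]
    norm_num
    rw [hc]
    nlinarith
  · obtain ⟨s, rfl⟩ : ∃ s, m = 3 + s := ⟨m - 3, by omega⟩
    have p3 := h.1 3 (by omega)
    have q3 := (h.2 1 (by omega)).1
    norm_num at q3
    have c21 : α * c 2 ≤ t * c 1 := by
      rw [hc] at q1 ⊢
      have : c 0 * (α * c 2) ≤ c 0 * (t * (t * c 0)) := by nlinarith
      exact le_of_mul_le_mul_left this p0
    have c32 : c 3 ≤ 0.06 * c 2 := by
      have a1 : α * (α * c 3) * c 1 ≤ t * c 2 * c 1 := by nlinarith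
      have a2 : α * (α * c 3) ≤ t * c 2 := le_of_mul_le_mul_right a1 p1
      have : 10.4 * c 3 ≤ 0.56 * c 2 := by
        have b1 : 10.4 ≤ α * α := by nlinarith
        have b2 := mul_le_mul_of_nonneg_right b1 p3.le
        have b3 := mul_le_mul_of_nonneg_right t1.le p2.le
        linarith
      linarith
    have tail := alt_sum s (fun j => c (3 + j)) (fun j hj => h.1 _ (by omega))
      (fun j hj => dec (3 + j) (by omega))
    rw [show 3 + s + 1 = 3 + (s + 1) by ring, Finset.sum_range_add]
    have e : ∑ x ∈ Finset.range (s+1), (-1 : ℝ) ^ (3 + x) * c (3 + x) =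
        - ∑ x ∈ Finset.range (s+1), (-1 : ℝ) ^ x * c (3 + x) := by
      rw [← Finset.sum_neg_distrib]
      exact Finset.sum_congr rfl fun k _ => by ring
    rw [e]
    have t2 := tail.2
    simp only [add_zero] at t2
    have : ∑ x ∈ Finset.range 3, (-1 : ℝ) ^ x * c x = c 0 - c 1 + c 2 := by
      simp only [Finset.sum_range_succ, Finset.sum_range_zero]; ring
    rw [this, hc]
    nlinarith

lemma edge_num {α β u : ℝ} {b : ℕ → ℝ} (h1 : 3.23 ≤ α) (h2 : α < 4)
    (hβ : β * (α * (4 - α)) = 8) (hαβ : α ≤ β) (u0 : 0 < u) (u1 : u < 1)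
    (hu : u ^ 2 - α * β / 2 * u + β = 0)
    (p0 : 0 < b 0) (p1 : 0 < b 1) (p2 : 0 < b 2) (p3 : 0 < b 3) (b2 : b 2 = u * b 1)
    (q0 : α * (b 0 * b 2) ≤ b 1 ^ 2)
    (q1 : α * (b 1 * b 3) ≤ b 2 ^ 2 ∧ b 2 ^ 2 ≤ β * (b 1 * b 3))
    (q2 : α * (b 2 * b 4) ≤ b 3 ^ 2) : b 0 - b 1 + b 2 - b 3 + b 4 ≤ 0 := by
  have hα0 : 0 < α := by linarith
  have hβ0 : 0 < β := by linarith
  have uα : 2 < α * u := by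
    have : β * 2 < β * (α * u) := by nlinarith
    exact lt_of_mul_lt_mul_left this hβ0.le
  -- normalise `b 1 = 1`
  have r0 : b 0 ≤ b 1 / (α * u) := by
    rw [le_div_iff₀ (by positivity)]
    rw [b2] at q0
    have : b 1 * (b 0 * (α * u)) ≤ b 1 * b 1 := by nlinarith
    exact le_of_mul_le_mul_left this p1
  have r3 : u ^ 2 / β * b 1 ≤ b 3 := by
    rw [div_mul_eq_mul_div, div_le_iff₀ hβ0]
    have := q1.2
    rw [b2] at this
    have : b 1 * (u ^ 2 * b 1) ≤ b 1 * (b 3 * β) := by nlinarith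
    exact le_of_mul_le_mul_left this p1
  have r3' : b 3 ≤ u ^ 2 / α * b 1 := by
    rw [div_mul_eq_mul_div, le_div_iff₀ hα0]
    have := q1.1
    rw [b2] at this
    have : b 1 * (b 3 * α) ≤ b 1 * (u ^ 2 * b 1) := by nlinarith
    exact le_of_mul_le_mul_left this p1
  have r4 : b 4 ≤ b 3 ^ 2 / (α * u * b 1) := by
    rw [le_div_iff₀ (by positivity)]
    rw [b2] at q2
    nlinarith
  set v := b 3 / b 1 with hv
  have hv3 : b 3 = v * b 1 := by rw [hv]; field_simp
  rw [hv3] at r3 r3' r4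
  have v1 : u ^ 2 / β ≤ v := le_of_mul_le_mul_right r3 p1
  have v2 : v ≤ u ^ 2 / α := le_of_mul_le_mul_right r3' p1
  have r4' : b 4 ≤ v ^ 2 / (α * u) * b 1 := by
    refine r4.trans (le_of_eq ?_)
    field_simp
  have r0' : b 0 ≤ 1 / (α * u) * b 1 := by
    refine r0.trans (le_of_eq ?_)
    field_simp
  rw [b2, hv3]
  have key : 1 / (α * u) - 1 + u - v + v ^ 2 / (α * u) ≤ 0 := by
    have base : 1 / (α * u) - 1 + u - (u^2/β) + (u^2/β) ^ 2 / (α * u) = 0 := by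
      have : β ^ 2 - α * u * β^2 + α * u^2 * β ^2 - α * u^3 * β + u^4 = 0 := by
        have hu' : u^2 + β = α * β / 2 * u := by linarith
        have e1 : (u^2 + β)^2 = (α * β / 2 * u)^2 := by rw [hu']
        have e2 : α * β * u * (u^2+β) = α * β * u * (α * β / 2 * u) := by rw [hu']
        linear_combination e1 - e2 + u^2 * β / 4 * hβ
      field_simp
      linear_combination this
    have mono : (v - u^2/β) * (1 - (v + u^2/β) / (α * u)) ≥ 0 := by
      apply mul_nonneg
      · linarith
      · rw [sub_nonneg, div_le_one (by positivity)]
        have : u^2/α ≤ 1 := by rw [div_le_one hα0]; nlinarith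
        linarith
    have e3 : (1 / (α * u) - 1 + u - (u^2/β) + (u^2/β) ^ 2 / (α * u)) - (1 / (α * u) - 1 + u - v + v ^ 2 / (α * u)) = (v - u^2/β) * (1 - (v + u^2/β) / (α * u)) := by
      ring
    linarith
  have := mul_nonpos_of_nonpos_of_nonneg key p1.le
  nlinarith

/-- The edge estimate. -/
lemma edge {α β : ℝ} (h1 : 3.23 ≤ α) (h2 : α < 4) (hβ : β * (α * (4 - α)) = 8) (hαβ : α ≤ β)
    {n : ℕ} (hn : 5 ≤ n) {c : ℕ → ℝ} (h : QC α β n c) :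
    ∃ x, c 0 / c 1 < x ∧ x < c 1 / c 2 ∧
      ∑ j ∈ Finset.range (n+1), (-1 : ℝ) ^ j * (c j * x ^ j) < 0 := by
  obtain ⟨u, ⟨u0, u1⟩, hu⟩ : ∃ u ∈ Set.Ioo (0:ℝ) 1, u ^ 2 - α * β / 2 * u + β = 0 := by
    have hcont : ContinuousOn (fun u : ℝ => u ^ 2 - α * β / 2 * u + β) (Set.Icc 0 1) := by
      fun_prop
    have := intermediate_value_Ioo' (zero_le_one) hcont
    exact this ⟨by nlinarith, by nlinarith⟩
  have hα0 : 0 < α := by linarith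
  have hβ0 : 0 < β := by linarith
  have uα : 2 < α * u := by
    have : β * 2 < β * (α * u) := by nlinarith
    exact lt_of_mul_lt_mul_left this hβ0.le
  have p0 := h.1 0 (by omega)
  have p1 := h.1 1 (by omega)
  have p2 := h.1 2 (by omega)
  have x0 : 0 < u * (c 1 / c 2) := by positivity
  have q := (h.2 0 (by omega)).1
  simp only [zero_add] at q
  refine ⟨u * (c 1 / c 2), ?_, ?_, ?_⟩
  · rw [← mul_div_assoc, div_lt_div_iff₀ p1 p2]
    nlinarith [mul_pos p0 p2]
  · have : 0 < c 1 / c 2 := by positivity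
    nlinarith
  set x := u * (c 1 / c 2) with hx
  have hb := h.scale x0
  set b : ℕ → ℝ := fun j => c j * x ^ j with hbdef
  have b2 : b 2 = u * b 1 := by
    simp only [hbdef, hx]; field_simp
  show ∑ j ∈ Finset.range (n+1), (-1 : ℝ) ^ j * b j < 0
  clear_value b
  clear hbdef hx x0 q p0 p1 p2 
  have p0 := hb.1 0 (by omega)
  have p1 := hb.1 1 (by omega)
  have p2 := hb.1 2 (by omega)
  have p3 := hb.1 3 (by omega)
  have p4 := hb.1 4 (by omega)
  have hs : QC α β (n-1) (fun j => b (1 + j)) := hb.shift (by omega)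
  have dec := hs.dec (by linarith) (by show b 2 < b 1; nlinarith)
  obtain ⟨s, rfl⟩ : ∃ s, n = 5 + s := ⟨n - 5, by omega⟩
  have tail := alt_sum s (fun j => b (5 + j)) (fun j hj => hb.1 _ (by omega))
      (fun j hj => by
        have := dec (4 + j) (by omega)
        rw [show 1 + (4 + j + 1) = 5 + (j + 1) by ring, show 1 + (4 + j) = 5 + j by ring] at this
        exact this)
  rw [show 5 + s + 1 = 5 + (s + 1) by ring, Finset.sum_range_add]
  have e : ∑ x ∈ Finset.range (s+1), (-1 : ℝ) ^ (5 + x) * b (5 + x) =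
        - ∑ x ∈ Finset.range (s+1), (-1 : ℝ) ^ x * b (5 + x) := by
      rw [← Finset.sum_neg_distrib]
      exact Finset.sum_congr rfl fun k _ => by ring
  rw [e]
  have t1 := tail.1
  have : ∑ x ∈ Finset.range 5, (-1 : ℝ) ^ x * b x = b 0 - b 1 + b 2 - b 3 + b 4 := by
      simp only [Finset.sum_range_succ, Finset.sum_range_zero]; ring
  rw [this]
  have q0 := (hb.2 0 (by omega)).1
  have q1 := (hb.2 1 (by omega))
  have q2 := (hb.2 2 (by omega)).1
  norm_num at q0 q1 q2
  suffices b 0 - b 1 + b 2 - b 3 + b 4 ≤ 0 by linarith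
  exact edge_num h1 h2 hβ hαβ u0 u1 hu p0 p1 p2 p3 b2 q0 q1 q2

lemma refl_sum (m : ℕ) (b : ℕ → ℝ) :
    (-1 : ℝ) ^ m * ∑ j ∈ Finset.range (m+1), (-1 : ℝ) ^ j * b j =
      ∑ j ∈ Finset.range (m+1), (-1 : ℝ) ^ j * b (m - j) := by
  rw [← Finset.sum_range_reflect, Finset.mul_sum]
  refine Finset.sum_congr rfl fun j hj => ?_
  have hj : j ≤ m := by simpa [Nat.lt_succ_iff] using hj
  obtain ⟨d, rfl⟩ := Nat.exists_eq_add_of_le hj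
  rw [show j + d + 1 - 1 - j = d by omega, show j + d - j = d by omega, ← mul_assoc, ← pow_add,
    show j + d + d = j + 2 * d by ring, pow_add, pow_mul]
  norm_num

lemma sum_split (k m : ℕ) (b : ℕ → ℝ) :
    (-1 : ℝ) ^ k * ∑ j ∈ Finset.range (k + m + 1), (-1 : ℝ) ^ j * b j =
      ∑ j ∈ Finset.range (k+1), (-1 : ℝ) ^ j * b (k - j) +
      ∑ j ∈ Finset.range (m+1), (-1 : ℝ) ^ j * b (k + j) - b k := by
  rw [← refl_sum, Finset.sum_range_succ _ k, show k + m + 1 = k + (m + 1) by ring,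
    Finset.sum_range_add, mul_add, mul_add]
  have hk : (-1 : ℝ) ^ k * (-1) ^ k = 1 := by rw [← mul_pow]; norm_num
  have e : (-1 : ℝ) ^ k * ∑ j ∈ Finset.range (m+1), (-1 : ℝ) ^ (k + j) * b (k + j) =
      ∑ j ∈ Finset.range (m+1), (-1 : ℝ) ^ j * b (k + j) := by
    rw [Finset.mul_sum]
    refine Finset.sum_congr rfl fun j _ => ?_
    rw [pow_add]
    linear_combination ((-1) ^ j * b (k+j)) * hk
  rw [e]
  linear_combination (-b k) * hk

lemma signs {α β : ℝ} (h1 : 3.23 ≤ α) (h2 : α < 4) (hβ : β * (α * (4 - α)) = 8) (hαβ : α ≤ β)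
    {n : ℕ} (hn : 5 ≤ n) {a : ℕ → ℝ} (h : QC α β n a) (k : ℕ) (hk : k ≤ n) :
    ∃ x, 0 < x ∧ (∀ i, i + 1 = k → a i / a (i+1) < x) ∧ (k < n → x < a k / a (k+1)) ∧
      0 < (-1 : ℝ) ^ k * ∑ j ∈ Finset.range (n+1), (-1 : ℝ) ^ j * (a j * x ^ j) := by
  have hα : 1 < α := by linarith
  obtain rfl | rfl | rfl | rfl | ⟨hk1, hk2⟩ :
      k = 0 ∨ k = n ∨ k = 1 ∨ n = k + 1 ∨ (2 ≤ k ∧ k + 2 ≤ n) := by omega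
  · have p0 := h.1 0 (by omega)
    have p1 := h.1 1 (by omega)
    have x0 : 0 < a 0 / a 1 / 2 := by positivity
    refine ⟨a 0 / a 1 / 2, x0, by intro i hi; omega, fun _ => ?_, ?_⟩
    · exact half_lt_self (by positivity)
    · have hs := h.scale x0
      have := (alt_sum n _ hs.1 (hs.dec hα (by
        simp only [pow_one, pow_zero, mul_one]
        have : a 1 * (a 0 / a 1 / 2) = a 0 / 2 := by field_simp
        rw [this]; linarith))).1
      simpa using this
  · obtain ⟨m, rfl⟩ : ∃ m, k = m + 1 := ⟨k - 1, by omega⟩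
    have p0 := h.1 m (by omega)
    have p1 := h.1 (m+1) (by omega)
    have x0 : 0 < 2 * (a m / a (m+1)) := by positivity
    refine ⟨2 * (a m / a (m+1)), x0, ?_, by omega, ?_⟩
    · intro i hi
      obtain rfl : i = m := by omega
      have : 0 < a i / a (i+1) := by positivity
      linarith
    · have hs := (h.scale x0).rev
      have := (alt_sum _ _ hs.1 (hs.dec hα (by
        simp only [Nat.add_sub_cancel, Nat.sub_zero]
        set x := 2 * (a m / a (m+1)) with hx
        have : a (m+1) * x ^ (m+1) = 2 * (a m * x ^ m) := by
          rw [pow_succ]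
          have : a (m+1) * x = 2 * a m := by rw [hx]; field_simp
          linear_combination (x ^ m) * this
        rw [this]
        have : 0 < a m * x ^ m := by positivity
        linarith))).1
      rw [refl_sum (m+1) (fun j => a j * (2 * (a m / a (m+1))) ^ j)]
      exact this
  · obtain ⟨x, e1, e2, e3⟩ := edge h1 h2 hβ hαβ hn h
    have p0 := h.1 0 (by omega)
    have p1 := h.1 1 (by omega)
    refine ⟨x, lt_trans (by positivity) e1, ?_, fun _ => e2, by linarith⟩
    intro i hi
    obtain rfl : i = 0 := by omega
    exact e1
  · obtain ⟨x, e1, e2, e3⟩ := edge h1 h2 hβ hαβ hn h.rev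
    obtain ⟨m, rfl⟩ : ∃ m, k = m + 1 := ⟨k - 1, by omega⟩
    rw [show m + 1 + 1 - 0 = m + 2 by omega, show m + 1 + 1 - 1 = m + 1 by omega] at e1
    rw [show m + 1 + 1 - 2 = m by omega, show m + 1 + 1 - 1 = m + 1 by omega] at e2
    have p0 := h.1 m (by omega)
    have p1 := h.1 (m+1) (by omega)
    have p2 := h.1 (m+2) (by omega)
    have x0 : 0 < x := lt_trans (by positivity) e1
    refine ⟨x⁻¹, inv_pos.2 x0, ?_, fun _ => ?_, ?_⟩
    · intro i hi
      obtain rfl : i = m := by omega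
      rw [lt_inv_comm₀ (by positivity) x0, inv_div]
      exact e2
    · rw [inv_lt_comm₀ x0 (by positivity), inv_div]
      exact e1
    · have r := refl_sum (m+1+1) (fun j => a j * x⁻¹ ^ j)
      have e : ∑ j ∈ Finset.range (m+1+1+1), (-1 : ℝ) ^ j * (a (m+1+1-j) * x⁻¹ ^ (m+1+1-j)) =
          x⁻¹ ^ (m+1+1) * ∑ j ∈ Finset.range (m+1+1+1), (-1 : ℝ) ^ j * (a (m+1+1-j) * x ^ j) := by
        rw [Finset.mul_sum]
        refine Finset.sum_congr rfl fun j hj => ?_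
        have hj : j ≤ m + 1 + 1 := by simpa [Nat.lt_succ_iff] using hj
        have : x⁻¹ ^ (m+1+1-j) = x⁻¹ ^ (m+1+1) * x ^ j := by
          rw [pow_sub₀ _ (inv_ne_zero x0.ne') hj]; simp
        rw [this]; ring
      rw [e] at r
      have : x⁻¹ ^ (m+1+1) * ∑ j ∈ Finset.range (m+1+1+1), (-1 : ℝ) ^ j * (a (m+1+1-j) * x ^ j) < 0 :=
        mul_neg_of_pos_of_neg (by positivity) e3
      rw [← r, pow_succ] at this
      linarith
  · obtain ⟨i, rfl⟩ : ∃ i, k = i + 1 := ⟨k - 1, by omega⟩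
    obtain ⟨m, rfl⟩ : ∃ m, n = i + 1 + m := ⟨n - (i+1), by omega⟩
    have p0 := h.1 i (by omega)
    have p1 := h.1 (i+1) (by omega)
    have p2 := h.1 (i+2) (by omega)
    obtain ⟨x, x0, hx⟩ : ∃ x : ℝ, 0 < x ∧ x ^ 2 = a i / a (i+2) :=
      ⟨√(a i / a (i+2)), Real.sqrt_pos.2 (by positivity), Real.sq_sqrt (by positivity)⟩
    have hx' : a (i+2) * x ^ 2 = a i := by rw [hx]; field_simp
    have q := (h.2 i (by omega)).1
    set t := a i / (x * a (i+1)) with ht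
    have t0 : 0 < t := by positivity
    have ta : a i = t * (x * a (i+1)) := by rw [ht]; field_simp
    have t2 : t ^ 2 * α ≤ 1 := by
      have e : α * (a i * a (i+2)) * x ^ 2 = t ^ 2 * α * (a (i+1) ^ 2 * x ^ 2) := by
        have : α * (a i * a (i+2)) * x ^ 2 = α * a i ^ 2 := by
          rw [mul_assoc, mul_assoc, hx']; ring
        rw [this, ta]; ring
      have l := mul_le_mul_of_nonneg_right q (sq_nonneg x)
      rw [e] at l
      have : 0 < a (i+1) ^ 2 * x ^ 2 := by positivity
      nlinarith
    have t1 : t < 1 := by nlinarith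
    refine ⟨x, x0, ?_, fun _ => ?_, ?_⟩
    · intro i' hi
      obtain rfl : i' = i := by omega
      rw [div_lt_iff₀ p1, ta]
      have : 0 < x * a (i'+1) := by positivity
      nlinarith
    · rw [lt_div_iff₀ p2]
      have : x * (x * a (i+2)) < x * a (i+1) := by
        have e : x * (x * a (i+2)) = a i := by rw [← hx']; ring
        rw [e, ta]
        have : 0 < x * a (i+1) := by positivity
        nlinarith
      exact lt_of_mul_lt_mul_left this x0.le
    · have hs := h.scale x0
      have s1 := half_sum h1 h2 hβ hk1 (hs.take (show i + 1 ≤ i + 1 + m by omega)).rev t0 t2 (by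
        simp only [Nat.add_sub_cancel, Nat.sub_zero]
        rw [ta]; ring)
      have s2 := half_sum h1 h2 hβ (show 2 ≤ m by omega)
        (hs.shift (show i + 1 + m ≤ i + 1 + m by omega)) t0 t2 (by
        show a (i+2) * x ^ (i+2) = t * (a (i+1) * x ^ (i+1))
        have e : a (i+2) * x ^ (i+2) = a i * x ^ i := by rw [← hx']; ring
        rw [e, ta]; ring)
      rw [sum_split (i+1) m (fun j => a j * x ^ j)]
      simp only [Nat.sub_zero, add_zero] at s1 s2 ⊢
      linarith

lemma roots_exist {α β : ℝ} (h1 : 3.23 ≤ α) (h2 : α < 4) (hβ : β * (α * (4 - α)) = 8)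
    (hαβ : α ≤ β) {n : ℕ} (hn : 5 ≤ n) {a : ℕ → ℝ} (h : QC α β n a) :
    ∃ ρ : ℕ → ℝ, (∀ i, i < n → 0 < ρ i) ∧ (∀ i j, i < j → j < n → ρ i < ρ j) ∧
      ∀ i, i < n → ∑ j ∈ Finset.range (n+1), a j * (-ρ i) ^ j = 0 := by
  have hs := signs h1 h2 hβ hαβ hn h
  choose! x x0 xl xu xs using hs
  have hlt : ∀ i, i < n → x i < x (i+1) := fun i hi =>
    (xu i (by omega) hi).trans (xl (i+1) (by omega) i rfl)
  have ex : ∀ i, i < n → ∃ r, x i < r ∧ r < x (i+1) ∧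
      ∑ j ∈ Finset.range (n+1), (-1 : ℝ) ^ j * (a j * r ^ j) = 0 := by
    intro i hi
    have hc : ContinuousOn (fun r : ℝ =>
      (-1 : ℝ) ^ i * ∑ j ∈ Finset.range (n+1), (-1 : ℝ) ^ j * (a j * r ^ j))
        (Set.Icc (x i) (x (i+1))) := by fun_prop
    have s1 := xs i (by omega)
    have s2 := xs (i+1) (by omega)
    rw [pow_succ] at s2
    obtain ⟨r, ⟨hr1, hr2⟩, hr⟩ := intermediate_value_Ioo' (hlt i hi).le hc
      (show (0:ℝ) ∈ _ from ⟨by linarith, s1⟩)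
    refine ⟨r, hr1, hr2, ?_⟩
    exact (mul_eq_zero.1 hr).resolve_left (by positivity)
  choose! ρ r1 r2 r3 using ex
  refine ⟨ρ, fun i hi => (x0 i hi.le).trans (r1 i hi), ?_, ?_⟩
  · intro i j hij
    induction j, hij using Nat.le_induction with
    | base => intro hj; exact (r2 i (by omega)).trans (r1 (i+1) hj)
    | succ j hj ih =>
      intro hj'
      exact (ih (by omega)).trans ((r2 j (by omega)).trans (r1 (j+1) hj'))
  · intro i hi
    rw [← r3 i hi]
    refine Finset.sum_congr rfl fun j _ => ?_
    rw [neg_pow]; ring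

open Polynomial in
lemma factor {n : ℕ} {a ρ : ℕ → ℝ} (hρ : ∀ i j, i < j → j < n → ρ i < ρ j)
    (hr : ∀ i, i < n → ∑ j ∈ Finset.range (n+1), a j * (-ρ i) ^ j = 0) :
    (∑ j ∈ Finset.range (n+1), C (a j) * X ^ j : ℝ[X]) =
      C (a n) * ∏ i ∈ Finset.range n, (X + C (ρ i)) := by
  have inj : Set.InjOn (fun i => -ρ i) (Finset.range n : Set ℕ) := by
    intro i hi j hj hij
    simp only [Finset.coe_range, Set.mem_Iio] at hi hj
    rcases lt_trichotomy i j with hl | hl | hl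
    · have := hρ i j hl hj; simp only at hij; linarith
    · exact hl
    · have := hρ j i hl hi; simp only at hij; linarith
  have hm : (∏ i ∈ Finset.range n, (X + C (ρ i))).Monic :=
    monic_prod_of_monic _ _ fun i _ => monic_X_add_C _
  have hd : (∏ i ∈ Finset.range n, (X + C (ρ i))).degree = (n : WithBot ℕ) := by
    rw [degree_prod]; simp
  refine Polynomial.eq_of_degree_sub_lt_of_eval_finset_eq
    ((Finset.range n).image (fun i => -ρ i)) ?_ ?_
  · rw [Finset.card_image_of_injOn inj, Finset.card_range, Finset.sum_range_succ, add_sub_assoc,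
      ← mul_sub]
    have A : (∑ j ∈ Finset.range n, C (a j) * X ^ j : ℝ[X]).degree < n := by
      refine (degree_sum_le _ _).trans_lt ?_
      refine (Finset.sup_lt_iff (WithBot.bot_lt_coe n)).2 ?_
      intro j hj
      exact (degree_C_mul_X_pow_le _ _).trans_lt (WithBot.coe_lt_coe.2 (Finset.mem_range.1 hj))
    have B : (X ^ n - ∏ i ∈ Finset.range n, (X + C (ρ i)) : ℝ[X]).degree < n := by
      have := degree_sub_lt (p := (X ^ n : ℝ[X])) (q := ∏ i ∈ Finset.range n, (X + C (ρ i)))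
        (by rw [hd]; simp) (by simp) (by rw [hm.leadingCoeff]; simp)
      simpa using this
    have B' : (C (a n) * (X ^ n - ∏ i ∈ Finset.range n, (X + C (ρ i))) : ℝ[X]).degree < n :=
      lt_of_le_of_lt (by
        rw [degree_mul]
        calc _ ≤ 0 + _ := add_le_add_left degree_C_le _
          _ = _ := zero_add _) B
    exact (degree_add_le _ _).trans_lt (max_lt A B')
  · intro y hy
    obtain ⟨i, hi, rfl⟩ := Finset.mem_image.1 hy
    have hi' := Finset.mem_range.1 hi
    rw [eval_mul, eval_prod, Finset.prod_eq_zero hi (by simp), mul_zero, eval_finsetSum,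
      ← hr i hi']
    simp

lemma exists_C (z : ℂ) (hz : ¬ (z.im = 0 ∧ z.re < 0)) :
    ∃ K : ℝ, 0 < K ∧ ∀ ρ : ℝ, 0 < ρ → ρ ^ 2 ≤ ‖z + ρ‖ * (K + ρ) := by
  by_cases him : z.im = 0
  · have hre : 0 ≤ z.re := by
      by_contra hc; exact hz ⟨him, not_le.1 hc⟩
    refine ⟨1, one_pos, fun ρ hρ => ?_⟩
    have : ρ ≤ ‖z + ρ‖ := by
      have := Complex.re_le_norm (z + ρ)
      simp at this; linarith
    nlinarith
  · have hi : 0 < |z.im| := abs_pos.2 him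
    have hz0 : 0 < ‖z‖ := hi.trans_le (Complex.abs_im_le_norm z)
    set w := ‖z‖ with hw
    set K := 4 * w ^ 2 / |z.im| + 2 * w with hK
    have K1 : 2 * w ≤ K := by
      have : 0 ≤ 4 * w ^ 2 / |z.im| := by positivity
      linarith
    have K2 : 4 * w ^ 2 ≤ |z.im| * K := by
      have : |z.im| * K = 4 * w ^ 2 + |z.im| * (2 * w) := by rw [hK]; field_simp
      rw [this]; nlinarith
    refine ⟨K, by linarith, fun ρ hρ => ?_⟩
    have n1 : |z.im| ≤ ‖z + ρ‖ := by
      have := Complex.abs_im_le_norm (z + ρ)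
      simpa using this
    have n2 : ρ - w ≤ ‖z + ρ‖ := by
      have := norm_sub_norm_le (ρ : ℂ) (-z)
      rw [norm_neg, sub_neg_eq_add, add_comm (ρ : ℂ), Complex.norm_real, Real.norm_of_nonneg hρ.le] at this
      exact this
    have hKρ : 0 ≤ K + ρ := by linarith
    by_cases hc : 2 * w ≤ ρ
    · have := mul_le_mul_of_nonneg_right n2 hKρ
      nlinarith [mul_nonneg (sub_nonneg.2 hc) (show 0 ≤ K - w by linarith)]
    · push Not at hc
      have := mul_le_mul_of_nonneg_right n1 hKρ
      nlinarith

/-- **Corollary 1.** If `f(z) = ∑_{k=0}^∞ a_k z^k` is an entire function with positive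
coefficients and there is `α` with `1 + √5 ≤ α < 4` such that
`q_k(f) ∈ [α, 8/(α(4-α))]` for all `k ≥ 2`, then every complex zero of `f` is real
(and negative). -/
theorem hutchinson_interval_entire
    (a : ℕ → ℝ) (ha : ∀ k, 0 < a k)
    (f : ℂ → ℂ) (hf : ∀ z : ℂ, HasSum (fun k : ℕ => (a k : ℂ) * z ^ k) (f z))
    (α : ℝ) (hα1 : 1 + Real.sqrt 5 ≤ α) (hα2 : α < 4)
    (hq : ∀ k, 2 ≤ k →
      a (k - 1) ^ 2 / (a (k - 2) * a k) ∈ Set.Icc α (8 / (α * (4 - α)))) :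
    ∀ z : ℂ, f z = 0 → z.im = 0 ∧ z.re < 0 := by
  intro z hz
  by_contra hcon
  have h1 : 3.23 ≤ α := by
    have : (2.23 : ℝ) ≤ √5 := Real.le_sqrt_of_sq_le (by norm_num)
    linarith
  have hpos : 0 < α * (4 - α) := by nlinarith
  set β := 8 / (α * (4 - α)) with hβdef
  have hβ : β * (α * (4 - α)) = 8 := by rw [hβdef]; exact div_mul_cancel₀ _ hpos.ne'
  have hαβ : α ≤ β := (hq 2 le_rfl).1.trans (hq 2 le_rfl).2
  have hQ : ∀ n, QC α β n a := by
    intro n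
    refine ⟨fun k _ => ha k, fun k _ => ?_⟩
    have := hq (k+2) (by omega)
    rw [show k + 2 - 1 = k + 1 by omega, show k + 2 - 2 = k by omega] at this
    have p := mul_pos (ha k) (ha (k+2))
    exact ⟨(le_div_iff₀ p).1 this.1, (div_le_iff₀ p).1 this.2⟩
  obtain ⟨K, K0, hK⟩ := exists_C z hcon
  have key : ∀ n, 5 ≤ n → a 0 ^ 2 ≤ ‖∑ j ∈ Finset.range (n+1), (a j : ℂ) * z ^ j‖ *
      ‖∑ j ∈ Finset.range (n+1), (a j : ℂ) * (K : ℂ) ^ j‖ := by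
    intro n hn
    obtain ⟨ρ, r0, r1, r2⟩ := roots_exist h1 hα2 hβ hαβ hn (hQ n)
    have hP := factor r1 r2
    have ev : ∀ w : ℂ, ∑ j ∈ Finset.range (n+1), (a j : ℂ) * w ^ j =
        a n * ∏ i ∈ Finset.range n, (w + ρ i) := by
      intro w
      have := congrArg (Polynomial.aeval w) hP
      simpa [map_sum, map_prod] using this
    have e0 : a 0 = a n * ∏ i ∈ Finset.range n, ρ i := by
      have := ev 0
      rw [Finset.sum_range_succ'] at this
      simp at this
      exact_mod_cast this
    rw [ev, ev, norm_mul, norm_mul, norm_prod, norm_prod, Complex.norm_real,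
      Real.norm_of_nonneg (ha n).le, e0]
    have : ∏ i ∈ Finset.range n, ρ i ^ 2 ≤
        ∏ i ∈ Finset.range n, (‖z + ρ i‖ * ‖(K : ℂ) + ρ i‖) := by
      refine Finset.prod_le_prod (fun i _ => sq_nonneg _) fun i hi => ?_
      have hp := r0 i (Finset.mem_range.1 hi)
      rw [← Complex.ofReal_add, Complex.norm_real, Real.norm_of_nonneg (by linarith)]
      exact hK _ hp
    rw [Finset.prod_mul_distrib, Finset.prod_pow] at this
    have := mul_le_mul_of_nonneg_left this (sq_nonneg (a n))
    linarith
  have t1 := ((hf z).tendsto_sum_nat.comp (Filter.tendsto_add_atTop_nat 1)).norm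
  have t2 := ((hf K).tendsto_sum_nat.comp (Filter.tendsto_add_atTop_nat 1)).norm
  have t := t1.mul t2
  have := ge_of_tendsto t (Filter.eventually_atTop.2 ⟨5, fun n hn => key n hn⟩)
  rw [hz] at this
  simp only [norm_zero, zero_mul] at this
  have := pow_pos (ha 0) 2
  linarith
end

section
/- Let 0 < α < β be real numbers. Then the following two statements are equivalent: (a) for all q₂, q₃, q₄ ∈ [α, β], there exists a point x₀ ∈ (1, α) such that S_{q₂,q₃,q₄}(x₀) ≤ 0; (b) α ≥ 1 + √5, and if moreover α < 4 then β ≤ 8/(α(4 − α)). -/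
/-- The polynomial `S_{q₂,q₃,q₄}(x) = 1 - x + x²/q₂ - x³/(q₂² q₃) + x⁴/(q₂³ q₃² q₄)`. -/
noncomputable def Spoly (q2 q3 q4 x : ℝ) : ℝ :=
  1 - x + x ^ 2 / q2 - x ^ 3 / (q2 ^ 2 * q3) + x ^ 4 / (q2 ^ 3 * q3 ^ 2 * q4)

lemma S_mono_aux (v V u U w W : ℝ) (hv : 0 < v) (hvV : v ≤ V) (hV : V ≤ 1)
    (hU : 0 < U) (hUu : U ≤ u) (hu : u ≤ 1/3) (hw : 0 < w) (hwW : w ≤ W) (hW : W ≤ 1/3) :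
    v - v^2*u + v^3*u^2*w ≤ V - V^2*U + V^3*U^2*W := by
  have hu0 : 0 < u := hU.trans_le hUu
  have hW0 : 0 < W := hw.trans_le hwW
  have h1 : 0 ≤ v^3*u^2*(W-w) := mul_nonneg (by positivity) (by linarith)
  have hvW : v*W ≤ 1 := by nlinarith
  have h3 : v*W*(u+U) ≤ 1 := by
    have : 0 < v*W := by positivity
    nlinarith
  have h2 : 0 ≤ v^2*(u-U)*(1 - v*W*(u+U)) :=
    mul_nonneg (mul_nonneg (by positivity) (by linarith)) (by linarith)
  have h4 : 0 ≤ (V-v)*(1-(V+v)*U) := mul_nonneg (by linarith) (by nlinarith)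
  have h5 : v^3 ≤ V^3 := pow_le_pow_left₀ hv.le hvV 3
  have h6 : 0 ≤ (V^3-v^3)*(U^2*W) := mul_nonneg (by linarith) (by positivity)
  nlinarith

lemma S_mono (α β a b c x : ℝ) (hα : 3 ≤ α) (ha : a ∈ Set.Icc α β) (hb : b ∈ Set.Icc α β)
    (hc : c ∈ Set.Icc α β) (hx : x ∈ Set.Ioo 1 α) : Spoly a b c x ≤ Spoly α β α x := by
  obtain ⟨ha1, ha2⟩ := ha
  obtain ⟨hb1, hb2⟩ := hb
  obtain ⟨hc1, hc2⟩ := hc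
  obtain ⟨hx1, hx2⟩ := hx
  have hx0 : 0 < x := by linarith
  have hα0 : 0 < α := by linarith
  have ha0 : 0 < a := by linarith
  have hb0 : 0 < b := by linarith
  have hc0 : 0 < c := by linarith
  have hβ0 : 0 < β := by linarith
  have key := S_mono_aux (x/a) (x/α) (1/b) (1/β) (1/c) (1/α) (by positivity)
    (div_le_div_of_nonneg_left hx0.le hα0 ha1) ((div_le_one hα0).2 hx2.le) (by positivity)
    (one_div_le_one_div_of_le hb0 hb2) (one_div_le_one_div_of_le (by norm_num) (by linarith))
    (by positivity) (one_div_le_one_div_of_le hα0 hc1)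
    (one_div_le_one_div_of_le (by norm_num) (by linarith))
  have e : ∀ p q r : ℝ, 0 < p → 0 < q → 0 < r → Spoly p q r x =
      1 - x + x * (x/p - (x/p)^2*(1/q) + (x/p)^3*(1/q)^2*(1/r)) := by
    intro p q r hp hq hr
    unfold Spoly
    field_simp
    ring
  rw [e a b c ha0 hb0 hc0, e α β α hα0 hβ0 hα0]
  have := mul_le_mul_of_nonneg_left key hx0.le
  linarith

lemma S_sq (α β x : ℝ) (hα : 0 < α) (hβ : 0 < β) : Spoly α β α x =
    (1 + x^2/(α^2*β) - x/2)^2 + x^2 * ((4*α*β - 8 - α^2*β) / (4*α^2*β)) := by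
  unfold Spoly
  field_simp
  ring

lemma S_pos (α β x : ℝ) (hα : 0 < α) (hαβ : α < β) (hx : x ∈ Set.Ioo 1 α)
    (h : (α-2)*β ≤ 2) : 0 < Spoly α β α x := by
  obtain ⟨hx1, hx2⟩ := hx
  have hβ : 0 < β := by linarith
  have hx0 : 0 < x := by linarith
  set r := (1 + x^2/(α^2*β)) / x with hr
  set r0 := 1/α + 1/(α*β) with hr0
  have e0 : 1/2 ≤ r0 := by
    have : r0 - 1/2 = (2 - (α-2)*β) / (2*α*β) := by rw [hr0]; field_simp; ring
    have : 0 ≤ (2 - (α-2)*β) / (2*α*β) := div_nonneg (by linarith) (by positivity)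
    linarith
  have e1 : r0 ≤ r := by
    have e : r - r0 = (α - x) * (α*β - x) / (α^2*β*x) := by
      rw [hr, hr0]; field_simp; ring
    have : 0 ≤ (α - x) * (α*β - x) / (α^2*β*x) :=
      div_nonneg (mul_nonneg (by linarith) (by nlinarith)) (by positivity)
    linarith
  have e2 : Spoly α β α x = x^2 * (r^2 - r + (1/α - 2/(α^2*β))) := by
    rw [hr]; unfold Spoly; field_simp; ring
  have e3 : r0^2 - r0 + (1/α - 2/(α^2*β)) = (β*(β - α) + 1) / (α^2*β^2) := by
    rw [hr0]; field_simp; ring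
  have e4 : 0 < (β*(β - α) + 1) / (α^2*β^2) := by
    have : 0 < β * (β - α) := mul_pos hβ (by linarith)
    positivity
  rw [e2]
  have : 0 < r^2 - r + (1/α - 2/(α^2*β)) := by nlinarith
  positivity

theorem hutchinson_lemma_iff (α β : ℝ) (h0 : 0 < α) (hαβ : α < β) :
    (∀ q2 ∈ Set.Icc α β, ∀ q3 ∈ Set.Icc α β, ∀ q4 ∈ Set.Icc α β,
      ∃ x0 ∈ Set.Ioo (1 : ℝ) α, Spoly q2 q3 q4 x0 ≤ 0) ↔
    (1 + Real.sqrt 5 ≤ α ∧ (α < 4 → β ≤ 8 / (α * (4 - α)))) := by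
  have hβ : 0 < β := by linarith
  have s5 : Real.sqrt 5 ^ 2 = 5 := Real.sq_sqrt (by norm_num)
  have s50 : 0 ≤ Real.sqrt 5 := Real.sqrt_nonneg 5
  constructor
  · intro h
    obtain ⟨x, hx, hS⟩ := h α ⟨le_rfl, hαβ.le⟩ β ⟨hαβ.le, le_rfl⟩ α ⟨le_rfl, hαβ.le⟩
    have h1 : 2 < (α-2)*β := by
      by_contra hc
      exact absurd hS (not_le.2 (S_pos α β x h0 hαβ hx (not_lt.1 hc)))
    have h2 : 4*α*β - 8 - α^2*β ≤ 0 := by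
      by_contra hc
      have hc := not_le.1 hc
      have hx0 : 0 < x := by linarith [hx.1]
      rw [S_sq α β x h0 hβ] at hS
      have : 0 < x^2 * ((4*α*β - 8 - α^2*β) / (4*α^2*β)) := by positivity
      nlinarith [sq_nonneg (1 + x^2/(α^2*β) - x/2)]
    have hα2 : 0 < α - 2 := by
      by_contra hc
      nlinarith
    refine ⟨?_, fun h4 => ?_⟩
    · have hq : 0 ≤ α^2 - 2*α - 4 := by
        rcases lt_or_ge α 4 with h4 | h4
        · have : 0 ≤ (α*(4-α))*(β-α) :=
            mul_nonneg (mul_nonneg h0.le (by linarith)) (by linarith)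
          by_contra hc
          have : (α-2)*(α^2-2*α-4) < 0 := mul_neg_of_pos_of_neg hα2 (not_le.1 hc)
          nlinarith
        · nlinarith
      have : Real.sqrt 5 ≤ α - 1 := Real.sqrt_le_iff.2 ⟨by linarith, by nlinarith⟩
      linarith
    · rw [le_div_iff₀ (mul_pos h0 (by linarith))]
      nlinarith
  · rintro ⟨h1, h2⟩ a ha b hb c hc
    have hs2 : 2 ≤ Real.sqrt 5 := Real.le_sqrt_of_sq_le (by norm_num)
    have hα3 : 3 ≤ α := by linarith
    have hD : 4*α*β - 8 - α^2*β ≤ 0 := by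
      rcases lt_or_ge α 4 with h4 | h4
      · have := h2 h4
        rw [le_div_iff₀ (mul_pos h0 (by linarith))] at this
        nlinarith
      · have : 0 ≤ (α*β)*(α-4) := mul_nonneg (by positivity) (by linarith)
        nlinarith
    have hv : 2 < (α-2)*β := by nlinarith
    have hcont : ContinuousOn (fun x : ℝ => 1 + x^2/(α^2*β) - x/2) (Set.Icc 1 α) := by
      apply Continuous.continuousOn
      fun_prop
    have hivt := intermediate_value_Ioo' (by linarith : (1:ℝ) ≤ α) hcont
    have hmem : (0:ℝ) ∈ Set.Ioo (1 + α^2/(α^2*β) - α/2) (1 + (1:ℝ)^2/(α^2*β) - 1/2) := by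
      constructor
      · have e : 1 + α^2/(α^2*β) - α/2 = (2 - (α-2)*β) / (2*β) := by
          field_simp
          ring
        rw [e]
        exact div_neg_of_neg_of_pos (by linarith) (by positivity)
      · have : 0 < (1:ℝ)^2/(α^2*β) := by positivity
        linarith
    obtain ⟨x, hx, hx0⟩ := hivt hmem
    refine ⟨x, hx, (S_mono α β a b c x hα3 ha hb hc hx).trans ?_⟩
    rw [S_sq α β x h0 hβ]
    simp only at hx0
    rw [hx0]
    have : (4*α*β - 8 - α^2*β) / (4*α^2*β) ≤ 0 :=
      div_nonpos_of_nonpos_of_nonneg hD (by positivity)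
    have := mul_nonpos_of_nonneg_of_nonpos (sq_nonneg x) this
    linarith
end
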